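/- Let P ∈ ℂ[x,y,z] be a nonzero homogeneous polynomial, and define (f*P)(x,y,z) := P(x(x−y+z)+(x−y)z, x(x−y+z), z(x−y+z)). Write P(1+u+u²v, 1, u) = u^k·R(u,v) in ℂ[u,v] with R not divisible by u, and assume the genericity condition R(0,−1) ≠ 0. Then the unique natural number k' such that (f*P)(1, u, uv) = u^{k'}·S(u,v) with S not divisible by u equals k' = k. -/

import Mathlib

open MvPolynomial

/-- Scaling the arguments of a homogeneous polynomial of degree `d` by `c` scales its value
by `c ^ d`. -/
lemma aeval_mul_args_of_isHomogeneous {σ R A : Type*} [CommSemiring R] [CommSemiring A]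
    [Algebra R A] {P : MvPolynomial σ R} {d : ℕ} (hP : P.IsHomogeneous d) (c : A) (g : σ → A) :
    aeval (fun i => c * g i) P = c ^ d * aeval g P := by
  rw [aeval_def, aeval_def, eval₂_eq, eval₂_eq, Finset.mul_sum]
  refine Finset.sum_congr rfl fun m hm => ?_
  have hdeg : ∑ i ∈ m.support, m i = d := by
    rw [← hP (mem_support_iff.mp hm), Finsupp.weight_apply, Finsupp.sum]
    simp
  simp only [mul_pow, Finset.prod_mul_distrib, Finset.prod_pow_eq_pow_sum, hdeg]
  ring

/-- A bivariate polynomial vanishing on the line `X 0 = 0` is divisible by `X 0`. -/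
lemma X_zero_dvd_of_aeval_eq_zero {R : Type*} [CommRing R] {S : MvPolynomial (Fin 2) R}
    (h : aeval (![0, Polynomial.X] : Fin 2 → Polynomial R) S = 0) :
    (X 0 : MvPolynomial (Fin 2) R) ∣ S := by
  rw [← Ideal.mem_span_singleton, ← Ideal.Quotient.eq_zero_iff_mem]
  let I := Ideal.span {(X 0 : MvPolynomial (Fin 2) R)}
  have hcomp : ((Ideal.Quotient.mkₐ R I).comp
      (Polynomial.aeval (X 1 : MvPolynomial (Fin 2) R))).comp
      (aeval (![0, Polynomial.X] : Fin 2 → Polynomial R)) = Ideal.Quotient.mkₐ R I := by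
    ext i
    fin_cases i
    · have hX : Ideal.Quotient.mk I (X 0) = 0 :=
        Ideal.Quotient.eq_zero_iff_mem.mpr (Ideal.mem_span_singleton_self _)
      simp [hX]
    · simp
  simpa [h] using (DFunLike.congr_fun hcomp S).symm

/-- The exponent of `X` split off a power series with nonzero remaining constant coefficient
is unique. -/
lemma PowerSeries.eq_of_X_pow_mul_eq_X_pow_mul {B : Type*} [CommRing B] {a b : PowerSeries B}
    {m n : ℕ} (ha : constantCoeff a ≠ 0) (hb : constantCoeff b ≠ 0)
    (h : (X : PowerSeries B) ^ m * a = X ^ n * b) : m = n := by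
  rcases lt_trichotomy m n with hlt | rfl | hlt
  · have := congrArg (coeff m) h
    simp [coeff_X_pow_mul', hlt.not_ge, ha] at this
  · rfl
  · have := congrArg (coeff n) h
    simp [coeff_X_pow_mul', hlt.not_ge, hb.symm] at this

/-- Taking the constant coefficient commutes with substituting power series into a polynomial. -/
lemma constantCoeff_aeval_powerSeries {σ R B : Type*} [CommRing R] [CommRing B] [Algebra R B]
    (g : σ → PowerSeries B) (S : MvPolynomial σ R) :
    PowerSeries.constantCoeff (aeval g S) =
      aeval (fun i => PowerSeries.constantCoeff (g i)) S := by
  induction S using MvPolynomial.induction_on with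
  | C a => simp [PowerSeries.algebraMap_apply]
  | add p q hp hq => simp [hp, hq]
  | mul_X p i hp => simp [hp]

/-- Equation (A pullback nu1) of Lemma 12.2 (Example 3, the linearizable map):
for generic `P` (namely when the factor `R` in `P(1+u+u²v,1,u) = u^{ν₃(P)}·R` satisfies
`R(0,−1) ≠ 0`), the local index `ν₁` of the pull-back `f*P` with respect to the chart
`(u,v) ↦ [1 : u : uv]` equals `ν₃(P)`. -/
theorem stmt14 (P : MvPolynomial (Fin 3) ℂ) (hP : P ≠ 0) (d : ℕ)
    (hPhom : P.IsHomogeneous d)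
    (k : ℕ) (R : MvPolynomial (Fin 2) ℂ)
    (hR : ¬ (X 0 : MvPolynomial (Fin 2) ℂ) ∣ R)
    (hfact : aeval (![1 + X 0 + X 0 ^ 2 * X 1, 1, X 0] :
        Fin 3 → MvPolynomial (Fin 2) ℂ) P = X 0 ^ k * R)
    (hgen : eval (![0, -1] : Fin 2 → ℂ) R ≠ 0)
    (k' : ℕ) (S : MvPolynomial (Fin 2) ℂ)
    (hS : ¬ (X 0 : MvPolynomial (Fin 2) ℂ) ∣ S)
    (hfact' : aeval (![1, X 0, X 0 * X 1] : Fin 3 → MvPolynomial (Fin 2) ℂ)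
        (aeval (![X 0 * (X 0 - X 1 + X 2) + (X 0 - X 1) * X 2,
          X 0 * (X 0 - X 1 + X 2), X 2 * (X 0 - X 1 + X 2)] :
          Fin 3 → MvPolynomial (Fin 3) ℂ) P)
      = X 0 ^ k' * S) :
    k' = k := by
  -- Work over `ℂ[v]⟦u⟧`, where `L = 1 - u + u v` is invertible and
  -- `f̃(1, u, u v) = L • φ₃(u v, -L⁻¹)`.
  let u : PowerSeries (Polynomial ℂ) := PowerSeries.X
  let v : PowerSeries (Polynomial ℂ) := PowerSeries.C Polynomial.X
  let L := 1 - u + u * v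
  have hL0 : PowerSeries.constantCoeff L = 1 := by simp [L, u, v]
  obtain ⟨M, hM⟩ : ∃ M, L * M = 1 :=
    (PowerSeries.isUnit_iff_constantCoeff.mpr (hL0 ▸ isUnit_one)).exists_right_inv
  have hM0 : PowerSeries.constantCoeff M = 1 := by
    simpa [hL0] using congrArg PowerSeries.constantCoeff hM
  have h₃ := congrArg (aeval (![u * v, -M] : Fin 2 → PowerSeries (Polynomial ℂ))) hfact
  have h₁ := congrArg (aeval (![u, v] : Fin 2 → PowerSeries (Polynomial ℂ))) hfact'
  rw [map_mul, map_pow, ← AlgHom.comp_apply, comp_aeval] at h₃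
  rw [map_mul, map_pow, ← AlgHom.comp_apply, ← AlgHom.comp_apply, comp_aeval, comp_aeval] at h₁
  have hargs : (fun i => L * aeval (![u * v, -M] : Fin 2 → PowerSeries (Polynomial ℂ))
        ((![1 + X 0 + X 0 ^ 2 * X 1, 1, X 0] : Fin 3 → MvPolynomial (Fin 2) ℂ) i)) =
      fun i => aeval (fun j => aeval (![u, v] : Fin 2 → PowerSeries (Polynomial ℂ))
        ((![1, X 0, X 0 * X 1] : Fin 3 → MvPolynomial (Fin 2) ℂ) j))
        ((![X 0 * (X 0 - X 1 + X 2) + (X 0 - X 1) * X 2,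
          X 0 * (X 0 - X 1 + X 2), X 2 * (X 0 - X 1 + X 2)] :
          Fin 3 → MvPolynomial (Fin 3) ℂ) i) := by
    funext i
    fin_cases i
    · simp
      linear_combination (-(u * v) ^ 2) * hM
    · simp [L]
    · simp [L, mul_comm]
  have hscale := aeval_mul_args_of_isHomogeneous hPhom L (fun i => aeval
    (![u * v, -M] : Fin 2 → PowerSeries (Polynomial ℂ))
    ((![1 + X 0 + X 0 ^ 2 * X 1, 1, X 0] : Fin 3 → MvPolynomial (Fin 2) ℂ) i))
  rw [h₃, hargs, h₁] at hscale
  have hSv : PowerSeries.constantCoeff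
      (aeval (![u, v] : Fin 2 → PowerSeries (Polynomial ℂ)) S) ≠ 0 := by
    have hpt : (fun i => PowerSeries.constantCoeff
        ((![u, v] : Fin 2 → PowerSeries (Polynomial ℂ)) i)) = ![0, Polynomial.X] := by
      funext i
      fin_cases i <;> simp [u, v]
    rw [constantCoeff_aeval_powerSeries, hpt]
    exact fun h => hS (X_zero_dvd_of_aeval_eq_zero h)
  have hRv : PowerSeries.constantCoeff
      (aeval (![u * v, -M] : Fin 2 → PowerSeries (Polynomial ℂ)) R) ≠ 0 := by
    have hpt : (fun i => PowerSeries.constantCoeff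
        ((![u * v, -M] : Fin 2 → PowerSeries (Polynomial ℂ)) i)) =
        algebraMap ℂ (Polynomial ℂ) ∘ (![0, -1] : Fin 2 → ℂ) := by
      funext i
      fin_cases i <;> simp [u, hM0]
    rw [constantCoeff_aeval_powerSeries, hpt, aeval_algebraMap_apply]
    simpa [aeval_eq_eval] using hgen
  refine PowerSeries.eq_of_X_pow_mul_eq_X_pow_mul (b := v ^ k * L ^ d *
    aeval (![u * v, -M] : Fin 2 → PowerSeries (Polynomial ℂ)) R) hSv ?_ ?_
  · simpa [hL0, v] using hRv
  · simp only [aeval_X, Matrix.cons_val_zero] at hscale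
    linear_combination hscale
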